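/- arXiv:1308.6273 — 9 statements merged into one kernel-verified Lean document; each statement's English description precedes it below -/
import Mathlib

section
/- Let n, m, k be positive integers and μ > 0, and let A ∈ ℝ^{n×m} be μ-incoherent. Let X, X' ∈ ℝ^m be vectors whose supports each have size at most k and intersect in exactly one index i, and all of whose nonzero entries lie in {−1, 1}. Then |⟨AX, AX'⟩ − X_i·X'_i| ≤ k²μ/√n. In particular, if k²μ < √n/2 then |⟨AX, AX'⟩| > 1/2 and ⟨AX, AX'⟩ has the same sign as X_i·X'_i. -/
open Finset

/-- If every entry of the Gram matrix `Aᵀ * A` is within `ε` of the identity, then the inner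
product of `A x` and `A y` is within `ε * ‖x‖₁ * ‖y‖₁` of the inner product of `x` and `y`. -/
theorem abs_sum_mulVec_mul_mulVec_sub_le {ι κ : Type*} [Fintype ι] [Fintype κ] [DecidableEq κ]
    (A : Matrix ι κ ℝ) {ε : ℝ}
    (hA : ∀ j j', |(∑ r, A r j * A r j') - (if j = j' then 1 else 0)| ≤ ε) (x y : κ → ℝ) :
    |(∑ r, A.mulVec x r * A.mulVec y r) - ∑ j, x j * y j| ≤ (∑ j, |x j|) * (∑ j, |y j|) * ε := by
  have hgram : (∑ r, A.mulVec x r * A.mulVec y r) =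
      ∑ j, ∑ j', x j * y j' * ∑ r, A r j * A r j' := by
    simp only [Matrix.mulVec, dotProduct, sum_mul_sum]
    simp only [mul_sum]
    rw [sum_comm]
    refine sum_congr rfl fun j _ => ?_
    rw [sum_comm]
    exact sum_congr rfl fun j' _ => sum_congr rfl fun r _ => by ring
  have hdiff : (∑ r, A.mulVec x r * A.mulVec y r) - ∑ j, x j * y j =
      ∑ j, ∑ j', x j * y j' * ((∑ r, A r j * A r j') - (if j = j' then 1 else 0)) := by
    rw [hgram]
    simp [mul_sub, sum_sub_distrib]
  rw [hdiff, sum_mul_sum, sum_mul]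
  refine (abs_sum_le_sum_abs _ _).trans (sum_le_sum fun j _ => ?_)
  rw [sum_mul]
  refine (abs_sum_le_sum_abs _ _).trans (sum_le_sum fun j' _ => ?_)
  rw [abs_mul, abs_mul]
  exact mul_le_mul_of_nonneg_left (hA j j') (by positivity)

/-- The `ℓ¹` norm of a vector with entries in `{0, 1, -1}` is the size of its support. -/
theorem sum_abs_eq_card_support {κ : Type*} [Fintype κ] {x : κ → ℝ}
    (hx : ∀ j, x j = 0 ∨ x j = 1 ∨ x j = -1) :
    ∑ j, |x j| = ((univ.filter fun j => x j ≠ 0).card : ℝ) := by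
  rw [card_filter, Nat.cast_sum]
  refine sum_congr rfl fun j _ => ?_
  rcases hx j with h | h | h <;> simp [h]

/-- If `A` is a `μ`-incoherent `n × m` matrix and `X, X'` are `±1`-valued
sparse vectors whose supports (of size at most `k`) intersect exactly in the index `i`,
then `|⟨AX, AX'⟩ - X_i X'_i| ≤ k²μ/√n`; in particular if `k²μ < √n/2` then
`|⟨AX, AX'⟩| > 1/2` and `⟨AX, AX'⟩` has the same sign as `X_i X'_i`. -/
theorem unique_intersection_inner_product_sign
    (n m k : ℕ) (hn : 0 < n) (hm : 0 < m) (hk : 0 < k) (μ : ℝ) (hμ : 0 < μ)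
    (A : Matrix (Fin n) (Fin m) ℝ)
    (hcolnorm : ∀ j : Fin m, ∑ r, (A r j) ^ 2 = 1)
    (hincoh : ∀ j j' : Fin m, j ≠ j' → |∑ r, A r j * A r j'| ≤ μ / Real.sqrt n)
    (X X' : Fin m → ℝ) (i : Fin m)
    (hXcard : (univ.filter fun j => X j ≠ 0).card ≤ k)
    (hX'card : (univ.filter fun j => X' j ≠ 0).card ≤ k)
    (hinter : (univ.filter fun j => X j ≠ 0) ∩ (univ.filter fun j => X' j ≠ 0) = {i})
    (hXval : ∀ j, X j = 0 ∨ X j = 1 ∨ X j = -1)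
    (hX'val : ∀ j, X' j = 0 ∨ X' j = 1 ∨ X' j = -1) :
    |(∑ r, A.mulVec X r * A.mulVec X' r) - X i * X' i| ≤ k ^ 2 * μ / Real.sqrt n ∧
      ((k : ℝ) ^ 2 * μ < Real.sqrt n / 2 →
        1 / 2 < |∑ r, A.mulVec X r * A.mulVec X' r| ∧
          (0 < ∑ r, A.mulVec X r * A.mulVec X' r ↔ 0 < X i * X' i)) := by
  have hε : 0 ≤ μ / Real.sqrt n := by positivity
  have hmem : ∀ j, (X j ≠ 0 ∧ X' j ≠ 0) ↔ j = i := by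
    simpa [Finset.ext_iff] using hinter
  have hdot : ∑ j, X j * X' j = X i * X' i := by
    refine sum_eq_single i (fun j _ hj => ?_) (by simp)
    by_contra h
    exact hj ((hmem j).1 (mul_ne_zero_iff.1 h))
  have hA : ∀ j j', |(∑ r, A r j * A r j') - (if j = j' then 1 else 0)| ≤ μ / Real.sqrt n := by
    intro j j'
    by_cases h : j = j'
    · subst h
      simpa [← pow_two, hcolnorm] using hε
    · simpa [h] using hincoh j j' h
  have hbound : |(∑ r, A.mulVec X r * A.mulVec X' r) - X i * X' i| ≤
      k ^ 2 * μ / Real.sqrt n := by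
    have h := abs_sum_mulVec_mul_mulVec_sub_le A hA X X'
    rw [hdot, sum_abs_eq_card_support hXval, sum_abs_eq_card_support hX'val] at h
    refine h.trans ?_
    rw [mul_div_assoc, pow_two]
    gcongr
  refine ⟨hbound, fun hsmall => ?_⟩
  have hlt : (k : ℝ) ^ 2 * μ / Real.sqrt n < 1 / 2 := by
    rw [div_lt_iff₀ (by positivity)]
    linarith
  have hprod : X i * X' i = 1 ∨ X i * X' i = -1 := by
    obtain ⟨h, h'⟩ := (hmem i).2 rfl
    rcases (hXval i).resolve_left h with h | h <;>
      rcases (hX'val i).resolve_left h' with h' | h' <;> simp [h, h']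
  obtain ⟨hlower, hupper⟩ := abs_lt.1 (hbound.trans_lt hlt)
  rw [lt_abs]
  rcases hprod with h | h <;> rw [h] at hlower hupper ⊢
  · exact ⟨Or.inl (by linarith), iff_of_true (by linarith) (by norm_num)⟩
  · exact ⟨Or.inr (by linarith), iff_of_false (by linarith) (by norm_num)⟩
end

section
/- Let F₁, …, F_ℓ be a (k, Q)-family of ℓ finite sets, and let s be a positive integer with ℓ ≥ s + 1. Then the number of s-element subsets P of F₁ ∪ ⋯ ∪ F_ℓ that pierce the family F₁, …, F_ℓ is at most Q·s·(s+1)·(ℓk)^{s−1}. -/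
open Finset

/-- A finite set `P` pierces a family of sets `F` if it meets every member of the family. -/
def Pierces {α : Type*} [DecidableEq α] {ℓ : ℕ} (P : Finset α) (F : Fin ℓ → Finset α) : Prop :=
  ∀ i : Fin ℓ, (P ∩ F i).Nonempty

instance {α : Type*} [DecidableEq α] {ℓ : ℕ} (P : Finset α) (F : Fin ℓ → Finset α) :
    Decidable (Pierces P F) := by
  unfold Pierces; infer_instance

/-- A set with fewer elements than a subfamily it pierces contains a common point of two distinct
members of that subfamily. -/
theorem Pierces.exists_mem_inter {α : Type*} [DecidableEq α] {ℓ : ℕ} {P : Finset α}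
    {F : Fin ℓ → Finset α} (hP : Pierces P F) {I : Finset (Fin ℓ)} (hI : P.card < I.card) :
    ∃ i ∈ I, ∃ j ∈ I, i ≠ j ∧ ∃ x ∈ P, x ∈ F i ∩ F j := by
  choose f hf using hP
  simp only [mem_inter] at hf
  obtain ⟨i, hi, j, hj, hij, h⟩ :=
    exists_ne_map_eq_of_card_lt_of_maps_to hI (f := f) fun i _ => (hf i).1
  exact ⟨i, hi, j, hj, hij, f i, (hf i).1, mem_inter.2 ⟨(hf i).2, h ▸ (hf j).2⟩⟩

/-- If `F₁, …, F_ℓ` is a `(k, Q)`-family (each set has cardinality at most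
`k` and pairwise intersections have cardinality at most `Q`) and `ℓ ≥ s + 1`, then the
number of `s`-element subsets of `F₁ ∪ ⋯ ∪ F_ℓ` that pierce the family is at most
`Q·s·(s+1)·(ℓk)^{s-1}`. -/
theorem card_piercing_sets_le_of_kQ_family
    {α : Type*} [DecidableEq α] (ℓ k Q s : ℕ) (hs : 0 < s) (hℓs : s + 1 ≤ ℓ)
    (F : Fin ℓ → Finset α) (hF : ∀ i, (F i).card ≤ k)
    (hQ : ∀ i j : Fin ℓ, i ≠ j → ((F i) ∩ (F j)).card ≤ Q) :
    ((Finset.powersetCard s (Finset.univ.biUnion F)).filter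
        (fun P => Pierces P F)).card ≤ Q * s * (s + 1) * (ℓ * k) ^ (s - 1) := by
  obtain ⟨I, -, hI⟩ := exists_subset_card_eq (s := (univ : Finset (Fin ℓ))) (n := s + 1)
    (by simpa using hℓs)
  set U := univ.biUnion F
  have hUcard : U.card ≤ ℓ * k := by
    simpa using card_biUnion_le_card_mul univ F k fun i _ => hF i
  have hsub : (powersetCard s U).filter (fun P => Pierces P F) ⊆
      I.offDiag.biUnion fun p => ((F p.1 ∩ F p.2) ×ˢ powersetCard (s - 1) U).image
        fun q => insert q.1 q.2 := by
    intro P hP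
    obtain ⟨hPU, hP⟩ := mem_filter.1 hP
    obtain ⟨hPU, hPs⟩ := mem_powersetCard.1 hPU
    obtain ⟨i, hi, j, hj, hij, x, hxP, hx⟩ := hP.exists_mem_inter (I := I) (by omega)
    refine mem_biUnion.2 ⟨(i, j), mem_offDiag.2 ⟨hi, hj, hij⟩, mem_image.2
      ⟨(x, P.erase x), mem_product.2 ⟨hx, mem_powersetCard.2
        ⟨(erase_subset x P).trans hPU, ?_⟩⟩, insert_erase hxP⟩⟩
    rw [card_erase_of_mem hxP, hPs]
  have hoff : I.offDiag.card = (s + 1) * s := by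
    rw [offDiag_card, hI, Nat.mul_succ, Nat.add_sub_cancel]
  calc _ ≤ _ := card_le_card hsub
    _ ≤ I.offDiag.card * (Q * (ℓ * k) ^ (s - 1)) := by
      refine card_biUnion_le_card_mul _ _ _ fun p hp => card_image_le.trans ?_
      rw [card_product, card_powersetCard]
      exact Nat.mul_le_mul (hQ _ _ (mem_offDiag.1 hp).2.2)
        ((Nat.choose_le_pow _ _).trans (Nat.pow_le_pow_left hUcard _))
    _ = Q * s * (s + 1) * (ℓ * k) ^ (s - 1) := by rw [hoff]; ring
end

section
/- Let x and y be unit vectors in a real inner product space, let c ≥ 0 be a real number, and set x' = c·x. If ‖x' − y‖ ≤ ε for some ε < 1, then ‖x − y‖ ≤ ε·√(1 + ε²). -/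
/-- If `x` and `y` are unit vectors in a real inner product space,
`x' = c • x` is a nonnegative multiple of `x`, and `‖x' - y‖ ≤ ε < 1`, then
`‖x - y‖ ≤ ε √(1 + ε²)`. -/
theorem norm_sub_le_of_norm_smul_sub_le
    {E : Type*} [NormedAddCommGroup E] [InnerProductSpace ℝ E]
    (x y : E) (hx : ‖x‖ = 1) (hy : ‖y‖ = 1)
    (c : ℝ) (hc : 0 ≤ c) (ε : ℝ) (hε : ε < 1)
    (h : ‖c • x - y‖ ≤ ε) :
    ‖x - y‖ ≤ ε * Real.sqrt (1 + ε ^ 2) := by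
  have hε0 : 0 ≤ ε := (norm_nonneg _).trans h
  have hcxy : ‖c • x - y‖ ^ 2 = c ^ 2 - 2 * (c * inner ℝ x y) + 1 := by
    rw [norm_sub_sq_real, real_inner_smul_left, norm_smul, hx, hy, Real.norm_eq_abs, mul_one,
      sq_abs, one_pow]
  have hxy : ‖x - y‖ ^ 2 = 2 - 2 * inner ℝ x y := by
    rw [norm_sub_sq_real, hx, hy]
    ring
  have ht1 : inner ℝ x y ≤ 1 := by
    simpa [hx, hy] using real_inner_le_norm x y
  generalize inner ℝ x y = t at hcxy hxy ht1
  have hsq : c ^ 2 - 2 * (c * t) + 1 ≤ ε ^ 2 := hcxy ▸ pow_le_pow_left₀ (norm_nonneg _) h 2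
  have ht0 : 0 ≤ t := by
    by_contra! ht
    nlinarith [mul_nonneg hc (neg_nonneg.2 ht.le), sq_nonneg c]
  have hsin : 1 - t ^ 2 ≤ ε ^ 2 := by nlinarith [sq_nonneg (c - t)]
  refine (sq_le_sq₀ (norm_nonneg _) (by positivity)).1 ?_
  rw [hxy, mul_pow, Real.sq_sqrt (by positivity)]
  calc 2 - 2 * t ≤ (1 - t ^ 2) * (1 + (1 - t ^ 2)) := by
        have : 0 ≤ t * (1 - t) ^ 2 * (2 + t) :=
          mul_nonneg (mul_nonneg ht0 (sq_nonneg _)) (by linarith)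
        linarith
    _ ≤ ε ^ 2 * (1 + ε ^ 2) :=
        mul_le_mul hsin (by linarith) (by nlinarith) (sq_nonneg _)
end

section
/- Let n, m, k be positive integers and μ > 0 with k·μ/√n ≤ 1/6. Let A ∈ ℝ^{n×m} be μ-incoherent, and let B ∈ ℝ^{n×m} be a matrix whose columns satisfy ‖B_j − A_j‖ ≤ 1/(100k) for every j. Let X ∈ ℝ^m be a vector whose support has size at most k and all of whose nonzero entries lie in {−1, 1}, and set Y = AX. Then for every index i: |⟨Y, B_i⟩| > 1/2 if and only if X_i ≠ 0; moreover, when X_i ≠ 0 the inner product ⟨Y, B_i⟩ has the same sign as X_i. -/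
open Finset

/-- A vector within `ε` of a unit vector `a i` of an incoherent family has inner product within
`δ + ε` of the Kronecker delta with every member of the family. -/
lemma abs_sum_mul_sub_ite_le {ι κ : Type*} [Fintype ι] [DecidableEq κ] (a : κ → ι → ℝ)
    (b : ι → ℝ) {δ ε : ℝ} (hδ : 0 ≤ δ) (hnorm : ∀ j, ∑ r, a j r ^ 2 = 1)
    (hinc : ∀ j j', j ≠ j' → |∑ r, a j r * a j' r| ≤ δ) (i : κ)
    (hb : √(∑ r, (b r - a i r) ^ 2) ≤ ε) (j : κ) :
    |∑ r, a j r * b r - if j = i then 1 else 0| ≤ δ + ε := by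
  have hpert : |∑ r, a j r * (b r - a i r)| ≤ ε := by
    refine le_trans (Real.abs_le_sqrt ?_) hb
    simpa [hnorm j] using sum_mul_sq_le_sq_mul_sq univ (a j) (fun r => b r - a i r)
  have hbase : |∑ r, a j r * a i r - if j = i then 1 else 0| ≤ δ := by
    split_ifs with h
    · subst h
      simpa [← sq, hnorm j] using hδ
    · simpa using hinc j i h
  have hsplit : ∑ r, a j r * b r = ∑ r, a j r * a i r + ∑ r, a j r * (b r - a i r) := by
    rw [← sum_add_distrib]
    exact sum_congr rfl fun r _ => by ring
  rw [hsplit, add_sub_right_comm]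
  exact (abs_add_le _ _).trans (add_le_add hbase hpert)

/-- A weighted sum with weights in `[-1, 1]` and at most `k` nonzero weights is at most `k` times
a uniform bound on the terms. -/
lemma abs_sum_mul_le_of_card_support_le {κ : Type*} [Fintype κ] (x e : κ → ℝ) {k : ℕ} {c : ℝ}
    (hc : 0 ≤ c) (hx : ∀ j, |x j| ≤ 1) (hcard : #{j | x j ≠ 0} ≤ k) (he : ∀ j, |e j| ≤ c) :
    |∑ j, x j * e j| ≤ k * c := by
  have hsupp : ∑ j with x j ≠ 0, x j * e j = ∑ j, x j * e j :=
    sum_filter_of_ne fun j _ h => left_ne_zero_of_mul h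
  rw [← hsupp]
  calc |∑ j with x j ≠ 0, x j * e j| ≤ ∑ j with x j ≠ 0, |x j * e j| := abs_sum_le_sum_abs _ _
    _ ≤ ∑ j with x j ≠ 0, c := by
        refine sum_le_sum fun j _ => ?_
        rw [abs_mul]
        simpa using mul_le_mul (hx j) (he j) (abs_nonneg _) zero_le_one
    _ = (#{j | x j ≠ 0} : ℝ) * c := by rw [sum_const, nsmul_eq_mul]
    _ ≤ k * c := by gcongr

/-- Suppose `kμ/√n ≤ 1/6`, `A` is `μ`-incoherent, and `B` is a matrix
whose columns are `1/(100k)`-close to those of `A`. If `X` is `±1`-valued with support of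
size at most `k` and `Y = AX`, then for every index `i` we have `|⟨Y, B_i⟩| > 1/2` iff
`X_i ≠ 0`, and when `X_i ≠ 0` the inner product `⟨Y, B_i⟩` has the same sign as `X_i`. -/
theorem support_recovery_from_approximate_dictionary
    (n m k : ℕ) (hn : 0 < n) (hm : 0 < m) (hk : 0 < k) (μ : ℝ) (hμ : 0 < μ)
    (hkμ : k * μ / Real.sqrt n ≤ 1 / 6)
    (A B : Matrix (Fin n) (Fin m) ℝ)
    (hcolnorm : ∀ j : Fin m, ∑ r, (A r j) ^ 2 = 1)
    (hincoh : ∀ j j' : Fin m, j ≠ j' → |∑ r, A r j * A r j'| ≤ μ / Real.sqrt n)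
    (hB : ∀ j : Fin m, Real.sqrt (∑ r, (B r j - A r j) ^ 2) ≤ 1 / (100 * k))
    (X : Fin m → ℝ)
    (hXcard : (univ.filter fun j => X j ≠ 0).card ≤ k)
    (hXval : ∀ j, X j = 0 ∨ X j = 1 ∨ X j = -1) :
    ∀ i : Fin m,
      (1 / 2 < |∑ r, A.mulVec X r * B r i| ↔ X i ≠ 0) ∧
        (X i ≠ 0 → (0 < ∑ r, A.mulVec X r * B r i ↔ 0 < X i)) := by
  intro i
  have hk' : (0 : ℝ) < k := by exact_mod_cast hk
  have hδ : 0 ≤ μ / Real.sqrt n := by positivity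
  have hentry : ∀ j, |∑ r, A r j * B r i - if j = i then 1 else 0|
      ≤ μ / Real.sqrt n + 1 / (100 * k) :=
    abs_sum_mul_sub_ite_le (fun j r => A r j) (fun r => B r i) hδ hcolnorm hincoh i (hB i)
  have hX : ∀ j, |X j| ≤ 1 := fun j => by rcases hXval j with h | h | h <;> simp [h]
  have hinner : ∑ r, A.mulVec X r * B r i = ∑ j, X j * ∑ r, A r j * B r i := by
    simp only [Matrix.mulVec, dotProduct, sum_mul, mul_sum]
    rw [sum_comm]
    exact sum_congr rfl fun j _ => sum_congr rfl fun r _ => by ring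
  have hdev : |∑ r, A.mulVec X r * B r i - X i| ≤ k * (μ / Real.sqrt n + 1 / (100 * k)) := by
    have h := abs_sum_mul_le_of_card_support_le X _ (by positivity) hX hXcard hentry
    simpa [mul_sub, sum_sub_distrib, ← hinner] using h
  have hconst : k * (μ / Real.sqrt n + 1 / (100 * k)) ≤ 1 / 6 + 1 / 100 := by
    have h : (k : ℝ) * (1 / (100 * k)) = 1 / 100 := by field_simp
    rw [mul_add, h, ← mul_div_assoc]
    linarith
  obtain ⟨hlo, hhi⟩ := abs_le.mp (hdev.trans hconst)
  rcases hXval i with h | h | h <;> rw [h] at hlo hhi ⊢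
  · refine ⟨iff_of_false (not_lt.mpr (abs_le.mpr ⟨?_, ?_⟩)) (by simp), by simp⟩ <;> linarith
  · exact ⟨iff_of_true (lt_abs.mpr (.inl (by linarith))) (by simp),
      fun _ => iff_of_true (by linarith) (by simp)⟩
  · exact ⟨iff_of_true (lt_abs.mpr (.inr (by linarith))) (by simp),
      fun _ => iff_of_false (by linarith) (by norm_num)⟩
end

section
/- Let m, n, l be positive integers, and let A₁, …, A_m and B₁, …, B_m be vectors in ℝⁿ. For each i ∈ {1, …, l} let Ω⁽ⁱ⁾ ⊆ {1, …, m} be a set containing the index 1, let X⁽ⁱ⁾ ∈ ℝ^m be a vector supported on Ω⁽ⁱ⁾, and let M_i : ℝⁿ → ℝⁿ be a linear map satisfying M_i B₁ = 0 and M_i B_j = B_j for every j ∈ Ω⁽ⁱ⁾ \ {1}. Define Y⁽ⁱ⁾ = Σ_{j ∈ Ω⁽ⁱ⁾} X_j⁽ⁱ⁾ A_j and Q_i = Y⁽ⁱ⁾ − M_i Y⁽ⁱ⁾. Assume S := Σ_{i=1}^{l} X₁⁽ⁱ⁾ ≠ 0 and define B̂₁ = (Σ_{i=1}^{l} Q_i)/S.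 Then A₁ − B̂₁ = Σ_{i=1}^{l} (X₁⁽ⁱ⁾/S)·M_i(A₁ − B₁) − (1/S)·Σ_{i=1}^{l} Σ_{j ∈ Ω⁽ⁱ⁾ \ {1}} X_j⁽ⁱ⁾·(I − M_i)(A_j − B_j), where I denotes the identity map on ℝⁿ. -/
open Finset

/-- The key identity behind the analysis of `IterativeAverage`
(Lemma 5.2 of the paper): with `Y⁽ⁱ⁾ = Σ_{j ∈ Ω⁽ⁱ⁾} X_j⁽ⁱ⁾ A_j`,
`Q_i = Y⁽ⁱ⁾ − M_i Y⁽ⁱ⁾`, `S = Σ_i X_{j₀}⁽ⁱ⁾ ≠ 0` and `B̂ = (Σ_i Q_i)/S`, where each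
`M_i` kills `B_{j₀}` and fixes `B_j` for `j ∈ Ω⁽ⁱ⁾ \ {j₀}`, one has
`A_{j₀} − B̂ = Σ_i (X_{j₀}⁽ⁱ⁾/S) M_i(A_{j₀} − B_{j₀})
  − (1/S) Σ_i Σ_{j ∈ Ω⁽ⁱ⁾ \ {j₀}} X_j⁽ⁱ⁾ (I − M_i)(A_j − B_j)`. -/
theorem iterative_average_error_formula
    (m n l : ℕ) (hm : 0 < m) (hn : 0 < n) (hl : 0 < l)
    (A B : Fin m → (Fin n → ℝ)) (j₀ : Fin m)
    (Ω : Fin l → Finset (Fin m)) (hΩ : ∀ i, j₀ ∈ Ω i)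
    (X : Fin l → Fin m → ℝ) (hXsupp : ∀ i, ∀ j, j ∉ Ω i → X i j = 0)
    (M : Fin l → (Fin n → ℝ) →ₗ[ℝ] (Fin n → ℝ))
    (hM₀ : ∀ i, M i (B j₀) = 0)
    (hMfix : ∀ i, ∀ j ∈ Ω i, j ≠ j₀ → M i (B j) = B j)
    (Y : Fin l → Fin n → ℝ) (hY : ∀ i, Y i = ∑ j ∈ Ω i, X i j • A j)
    (Q : Fin l → Fin n → ℝ) (hQ : ∀ i, Q i = Y i - M i (Y i))
    (S : ℝ) (hS : S = ∑ i, X i j₀) (hS0 : S ≠ 0)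
    (Bhat : Fin n → ℝ) (hBhat : Bhat = S⁻¹ • ∑ i, Q i) :
    A j₀ - Bhat =
      (∑ i, (X i j₀ / S) • M i (A j₀ - B j₀)) -
        S⁻¹ • ∑ i, ∑ j ∈ (Ω i).erase j₀,
          X i j • ((A j - B j) - M i (A j - B j)) := by
  have hQ_split : ∀ i, Q i = X i j₀ • A j₀ - X i j₀ • M i (A j₀ - B j₀) +
      ∑ j ∈ (Ω i).erase j₀, X i j • ((A j - B j) - M i (A j - B j)) := by
    intro i
    have hB : ∀ j ∈ (Ω i).erase j₀,
        X i j • ((A j - B j) - M i (A j - B j)) = X i j • A j - M i (X i j • A j) := by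
      intro j hj
      rw [map_sub, hMfix i j (mem_of_mem_erase hj) (ne_of_mem_erase hj), map_smul, ← smul_sub]
      congr 1
      abel
    rw [hQ, hY, ← add_sum_erase _ _ (hΩ i), sum_congr rfl hB, sum_sub_distrib, map_add, map_sum,
      map_sub, hM₀, sub_zero, map_smul]
    abel
  have hA : A j₀ = S⁻¹ • ∑ i, X i j₀ • A j₀ := by
    rw [← sum_smul, ← hS, inv_smul_smul₀ hS0]
  have hM : ∑ i, (X i j₀ / S) • M i (A j₀ - B j₀) =
      S⁻¹ • ∑ i, X i j₀ • M i (A j₀ - B j₀) := by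
    simp only [smul_sum, smul_smul, div_eq_inv_mul]
  rw [hBhat, hM, sum_congr rfl fun i _ => hQ_split i, sum_add_distrib, sum_sub_distrib, smul_add,
    smul_sub, ← hA]
  abel
end

section
/- Let m, k be positive integers with k ≤ m, and let Ω¹, Ω², Ω³ ⊆ {1, …, m} be sets each of size at most k with Ω¹ ∩ Ω² ∩ Ω³ = ∅. Set a = |Ω¹ ∩ Ω²|, b = |Ω¹ ∩ Ω³|, c = |Ω² ∩ Ω³|. Let Ω be a uniformly random k-element subset of {1, …, m}. Then the probability that Ω intersects each of Ω¹, Ω² and Ω³ is at most k⁶/m³ + 3k³(a + b + c)/m². -/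
open Finset

lemma choose_sub_sub_mul_pow_le {m k : ℕ} (hkm : k ≤ m) {j : ℕ} (hj : j ≤ k) :
    (m - j).choose (k - j) * m ^ j ≤ k ^ j * m.choose k := by
  induction j with
  | zero => simp
  | succ j ih =>
    have key := Nat.add_one_mul_choose_eq (m - (j + 1)) (k - (j + 1))
    rw [show m - (j + 1) + 1 = m - j by omega, show k - (j + 1) + 1 = k - j by omega] at key
    have hfrac : (k - j) * m ≤ (m - j) * k := by
      zify [show j ≤ k by omega, show j ≤ m by omega]
      have : (j : ℤ) * k ≤ j * m := by gcongr
      linarith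
    have hstep : (m - (j + 1)).choose (k - (j + 1)) * m ≤ k * (m - j).choose (k - j) := by
      refine Nat.le_of_mul_le_mul_left ?_ (show 0 < m - j by omega)
      calc (m - j) * ((m - (j + 1)).choose (k - (j + 1)) * m)
          = (m - j).choose (k - j) * ((k - j) * m) := by rw [← mul_assoc, key, mul_assoc]
        _ ≤ (m - j).choose (k - j) * ((m - j) * k) := by gcongr
        _ = (m - j) * (k * (m - j).choose (k - j)) := by ring
    calc (m - (j + 1)).choose (k - (j + 1)) * m ^ (j + 1)
        = (m - (j + 1)).choose (k - (j + 1)) * m * m ^ j := by ring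
      _ ≤ k * (m - j).choose (k - j) * m ^ j := by gcongr
      _ = k * ((m - j).choose (k - j) * m ^ j) := by ring
      _ ≤ k * (k ^ j * m.choose k) := Nat.mul_le_mul_left _ (ih (by omega))
      _ = k ^ (j + 1) * m.choose k := by ring

lemma card_filter_superset_powersetCard_le {α : Type*} [Fintype α] [DecidableEq α]
    (k : ℕ) (T : Finset α) :
    #{Ω ∈ powersetCard k (univ : Finset α) | T ⊆ Ω} ≤
      (Fintype.card α - #T).choose (k - #T) := by
  rw [← card_compl, ← card_powersetCard]
  refine card_le_card_of_injOn (· \ T) (fun Ω hΩ => ?_) (fun A hA B hB hAB => ?_)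
  · simp only [coe_filter, mem_powersetCard_univ, Set.mem_ofPred_eq] at hΩ
    rw [mem_coe, mem_powersetCard, card_sdiff_of_subset hΩ.2, hΩ.1]
    exact ⟨fun x hx => by simpa using (mem_sdiff.1 hx).2, rfl⟩
  · simp only [coe_filter, Set.mem_ofPred_eq] at hA hB
    rw [← sdiff_union_of_subset hA.2, ← sdiff_union_of_subset hB.2]
    exact congrArg (· ∪ T) hAB

lemma card_filter_superset_powersetCard_le_div_pow {m k : ℕ} (hm : 0 < m) (hkm : k ≤ m)
    (T : Finset (Fin m)) :
    (#{Ω ∈ powersetCard k (univ : Finset (Fin m)) | T ⊆ Ω} : ℝ) ≤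
      ((k : ℝ) / m) ^ #T * m.choose k := by
  by_cases hT : #T ≤ k
  · have h := card_filter_superset_powersetCard_le k T
    rw [Fintype.card_fin] at h
    rw [div_pow, div_mul_eq_mul_div, le_div_iff₀ (by positivity)]
    exact_mod_cast (Nat.mul_le_mul_right _ h).trans (choose_sub_sub_mul_pow_le hkm hT)
  · rw [filter_false_of_mem]
    · simp only [card_empty, Nat.cast_zero]
      positivity
    · intro Ω hΩ hTΩ
      exact hT ((card_le_card hTΩ).trans_eq (mem_powersetCard_univ.1 hΩ))

lemma card_biUnion_filter_superset_powersetCard_le {ι : Type*} {m k : ℕ} (hm : 0 < m)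
    (hkm : k ≤ m) (s : Finset ι) (T : ι → Finset (Fin m)) {j : ℕ} (hT : ∀ i ∈ s, #(T i) = j) :
    (#(s.biUnion fun i => {Ω ∈ powersetCard k (univ : Finset (Fin m)) | T i ⊆ Ω}) : ℝ) ≤
      #s * (((k : ℝ) / m) ^ j * m.choose k) := by
  calc _ ≤ ((∑ i ∈ s, #{Ω ∈ powersetCard k (univ : Finset (Fin m)) | T i ⊆ Ω} : ℕ) : ℝ) :=
        Nat.cast_le.2 card_biUnion_le
    _ ≤ ∑ i ∈ s, ((k : ℝ) / m) ^ j * m.choose k := by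
        push_cast
        refine sum_le_sum fun i hi => ?_
        rw [← hT i hi]
        exact card_filter_superset_powersetCard_le_div_pow hm hkm (T i)
    _ = _ := by rw [sum_const, nsmul_eq_mul]

lemma card_biUnion_pair_superset_le {m k : ℕ} (hm : 0 < m) (hkm : k ≤ m)
    {A B : Finset (Fin m)} (hAB : Disjoint A B) (hB : #B ≤ k) :
    (#((A ×ˢ B).biUnion fun p =>
      {Ω ∈ powersetCard k (univ : Finset (Fin m)) | {p.1, p.2} ⊆ Ω}) : ℝ) ≤
      #A * k * (((k : ℝ) / m) ^ 2 * m.choose k) := by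
  refine (card_biUnion_filter_superset_powersetCard_le hm hkm (A ×ˢ B)
    (fun p => {p.1, p.2}) (j := 2) fun p hp => ?_).trans ?_
  · rw [mem_product] at hp
    exact card_pair (disjoint_iff_ne.1 hAB _ hp.1 _ hp.2)
  · rw [card_product, Nat.cast_mul]
    gcongr

/-- (Lemma 3.2 of the paper, for uniformly random `k`-subsets.)
If `Ω¹, Ω², Ω³ ⊆ {1,…,m}` have size at most `k` and empty common intersection, and
`Ω` is a uniformly random `k`-element subset of `{1,…,m}`, then the probability that `Ω`
meets each of `Ω¹, Ω², Ω³` is at most `k⁶/m³ + 3k³(a+b+c)/m²`, where `a, b, c` are the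
sizes of the pairwise intersections. -/
theorem prob_hits_all_three_of_no_common_intersection
    (m k : ℕ) (hm : 0 < m) (hk : 0 < k) (hkm : k ≤ m)
    (Ω₁ Ω₂ Ω₃ : Finset (Fin m))
    (hΩ₁ : Ω₁.card ≤ k) (hΩ₂ : Ω₂.card ≤ k) (hΩ₃ : Ω₃.card ≤ k)
    (hcommon : Ω₁ ∩ Ω₂ ∩ Ω₃ = ∅)
    (a b c : ℕ) (ha : a = (Ω₁ ∩ Ω₂).card) (hb : b = (Ω₁ ∩ Ω₃).card)
    (hc : c = (Ω₂ ∩ Ω₃).card) :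
    (((Finset.powersetCard k (Finset.univ : Finset (Fin m))).filter
          (fun Ω => (Ω ∩ Ω₁).Nonempty ∧ (Ω ∩ Ω₂).Nonempty ∧ (Ω ∩ Ω₃).Nonempty)).card : ℝ) /
        ((Finset.powersetCard k (Finset.univ : Finset (Fin m))).card : ℝ) ≤
      (k : ℝ) ^ 6 / (m : ℝ) ^ 3 + 3 * (k : ℝ) ^ 3 * ((a : ℝ) + b + c) / (m : ℝ) ^ 2 := by
  classical
  set P := powersetCard k (univ : Finset (Fin m)) with hP
  have hPcard : #P = m.choose k := by simp [hP]
  have hpos : (0 : ℝ) < m.choose k := by exact_mod_cast Nat.choose_pos hkm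
  have hmem : ∀ x, x ∈ Ω₁ → x ∈ Ω₂ → x ∈ Ω₃ → False := fun x h₁ h₂ h₃ => by
    have : x ∈ Ω₁ ∩ Ω₂ ∩ Ω₃ := by simp [h₁, h₂, h₃]
    simp [hcommon] at this
  set triples := {p ∈ Ω₁ ×ˢ Ω₂ ×ˢ Ω₃ | #{p.1, p.2.1, p.2.2} = 3} with htriples
  set U := triples.biUnion fun p => {Ω ∈ P | {p.1, p.2.1, p.2.2} ⊆ Ω} with hU
  let V (A B : Finset (Fin m)) := (A ×ˢ B).biUnion fun p => {Ω ∈ P | {p.1, p.2} ⊆ Ω}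
  have hcover : {Ω ∈ P | (Ω ∩ Ω₁).Nonempty ∧ (Ω ∩ Ω₂).Nonempty ∧ (Ω ∩ Ω₃).Nonempty} ⊆
      U ∪ (V (Ω₁ ∩ Ω₂) Ω₃ ∪ (V (Ω₁ ∩ Ω₃) Ω₂ ∪ V (Ω₂ ∩ Ω₃) Ω₁)) := by
    intro Ω hΩ
    obtain ⟨hΩP, ⟨x, hx⟩, ⟨y, hy⟩, ⟨z, hz⟩⟩ := mem_filter.1 hΩ
    rw [mem_inter] at hx hy hz
    have hV {A B : Finset (Fin m)} {u v : Fin m} (hu : u ∈ A) (hv : v ∈ B) (hu' : u ∈ Ω)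
        (hv' : v ∈ Ω) : Ω ∈ V A B :=
      mem_biUnion.2 ⟨(u, v), mem_product.2 ⟨hu, hv⟩,
        mem_filter.2 ⟨hΩP, by simp [insert_subset_iff, hu', hv']⟩⟩
    simp only [mem_union]
    by_cases hxy : x = y
    · subst hxy
      exact .inr (.inl (hV (mem_inter.2 ⟨hx.2, hy.2⟩) hz.2 hx.1 hz.1))
    by_cases hxz : x = z
    · subst hxz
      exact .inr (.inr (.inl (hV (mem_inter.2 ⟨hx.2, hz.2⟩) hy.2 hx.1 hy.1)))
    by_cases hyz : y = z
    · subst hyz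
      exact .inr (.inr (.inr (hV (mem_inter.2 ⟨hy.2, hz.2⟩) hx.2 hy.1 hx.1)))
    refine .inl (mem_biUnion.2 ⟨(x, y, z), mem_filter.2 ⟨?_, ?_⟩, mem_filter.2 ⟨hΩP, ?_⟩⟩)
    · simp [hx.2, hy.2, hz.2]
    · exact card_eq_three.2 ⟨x, y, z, hxy, hxz, hyz, rfl⟩
    · simp [insert_subset_iff, hx.1, hy.1, hz.1]
  have hUcard : (#U : ℝ) ≤ (k : ℝ) ^ 3 * (((k : ℝ) / m) ^ 3 * m.choose k) := by
    refine (card_biUnion_filter_superset_powersetCard_le hm hkm triples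
      (fun p => {p.1, p.2.1, p.2.2}) fun p hp => (mem_filter.1 hp).2).trans ?_
    have : #triples ≤ k ^ 3 := by
      calc #triples ≤ #Ω₁ * (#Ω₂ * #Ω₃) := by
            rw [← card_product, ← card_product]
            exact card_filter_le _ _
        _ ≤ k * (k * k) := by gcongr
        _ = k ^ 3 := by ring
    gcongr
    exact_mod_cast this
  have h₁₂ : (#(V (Ω₁ ∩ Ω₂) Ω₃) : ℝ) ≤ a * k * (((k : ℝ) / m) ^ 2 * m.choose k) :=
    ha ▸ card_biUnion_pair_superset_le hm hkm (disjoint_left.2 fun x hx h₃ =>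
      hmem x (mem_inter.1 hx).1 (mem_inter.1 hx).2 h₃) hΩ₃
  have h₁₃ : (#(V (Ω₁ ∩ Ω₃) Ω₂) : ℝ) ≤ b * k * (((k : ℝ) / m) ^ 2 * m.choose k) :=
    hb ▸ card_biUnion_pair_superset_le hm hkm (disjoint_left.2 fun x hx h₂ =>
      hmem x (mem_inter.1 hx).1 h₂ (mem_inter.1 hx).2) hΩ₂
  have h₂₃ : (#(V (Ω₂ ∩ Ω₃) Ω₁) : ℝ) ≤ c * k * (((k : ℝ) / m) ^ 2 * m.choose k) :=
    hc ▸ card_biUnion_pair_superset_le hm hkm (disjoint_left.2 fun x hx h₁ =>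
      hmem x h₁ (mem_inter.1 hx).1 (mem_inter.1 hx).2) hΩ₁
  have hunion : (#{Ω ∈ P | (Ω ∩ Ω₁).Nonempty ∧ (Ω ∩ Ω₂).Nonempty ∧ (Ω ∩ Ω₃).Nonempty} : ℝ) ≤
      #U + (#(V (Ω₁ ∩ Ω₂) Ω₃) + (#(V (Ω₁ ∩ Ω₃) Ω₂) + #(V (Ω₂ ∩ Ω₃) Ω₁))) := by
    exact_mod_cast (card_le_card hcover).trans <| (card_union_le _ _).trans <|
      Nat.add_le_add_left ((card_union_le _ _).trans <|
        Nat.add_le_add_left (card_union_le _ _) _) _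
  rw [hPcard, div_le_iff₀ hpos]
  have hslack : (0 : ℝ) ≤ 2 * ((a + b + c) * k * (((k : ℝ) / m) ^ 2 * m.choose k)) := by
    positivity
  calc _ ≤ (k : ℝ) ^ 3 * (((k : ℝ) / m) ^ 3 * m.choose k)
        + 3 * ((a + b + c) * k * (((k : ℝ) / m) ^ 2 * m.choose k)) := by linarith
    _ = _ := by
      rw [div_pow, div_pow]
      ring
end

section
/- Let m, k be positive integers with k ≤ m, let Ω ⊆ {1, …, m} be a fixed set of size k, and let Ω' be a uniformly random k-element subset of {1, …, m}. Then for every integer r ≥ 3, the probability that |Ω ∩ Ω'| ≥ r is at most C(k,3)·(k/m)³ / C(r,3), where C(·,·) denotes the binomial coefficient. -/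
open Finset

/-- The ratio of binomial coefficients `C(k,s) / C(m,s)` is at most `(k/m)^s`. -/
theorem choose_mul_pow_le_pow_mul_choose {k m : ℕ} (hkm : k ≤ m) (s : ℕ) :
    k.choose s * m ^ s ≤ k ^ s * m.choose s := by
  have descFactorial_le : ∀ t : ℕ,
      k.descFactorial t * m ^ t ≤ k ^ t * m.descFactorial t := by
    intro t
    induction t with
    | zero => simp
    | succ t ih =>
      have step : (k - t) * m ≤ k * (m - t) := by
        rw [Nat.sub_mul, Nat.mul_sub, mul_comm t m]
        exact Nat.sub_le_sub_left (by nlinarith) _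
      calc k.descFactorial (t + 1) * m ^ (t + 1)
          = (k - t) * m * (k.descFactorial t * m ^ t) := by
            rw [Nat.descFactorial_succ]; ring
        _ ≤ k * (m - t) * (k ^ t * m.descFactorial t) := Nat.mul_le_mul step ih
        _ = k ^ (t + 1) * m.descFactorial (t + 1) := by
            rw [Nat.descFactorial_succ]; ring
  have h := descFactorial_le s
  rw [Nat.descFactorial_eq_factorial_mul_choose, Nat.descFactorial_eq_factorial_mul_choose] at h
  refine Nat.le_of_mul_le_mul_left ?_ s.factorial_pos
  linarith

/-- Double counting of the pairs `T ⊆ A ∩ B` with `#T = s` and `#B = k`. -/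
theorem sum_choose_card_inter_powersetCard {α : Type*} [Fintype α] [DecidableEq α]
    (A : Finset α) {k s : ℕ} (hs : s ≤ k) :
    ∑ B ∈ powersetCard k (univ : Finset α), (A ∩ B).card.choose s =
      A.card.choose s * (Fintype.card α - s).choose (k - s) := by
  calc ∑ B ∈ powersetCard k (univ : Finset α), (A ∩ B).card.choose s
      = ∑ B ∈ powersetCard k (univ : Finset α), ((powersetCard s A).filter (· ⊆ B)).card := by
        refine sum_congr rfl fun B _ => ?_
        rw [← card_powersetCard]
        congr 1
        ext T
        simp only [mem_powersetCard, mem_filter, subset_inter_iff]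
        tauto
    _ = ∑ T ∈ powersetCard s A, ((powersetCard k (univ : Finset α)).filter (T ⊆ ·)).card := by
        simp only [card_filter]
        exact sum_comm
    _ = ∑ T ∈ powersetCard s A, (Fintype.card α - s).choose (k - s) := by
        refine sum_congr rfl fun T hT => ?_
        obtain ⟨-, rfl⟩ := mem_powersetCard.1 hT
        rw [card_filter_powersetCard_subset T univ k (subset_univ T) hs, card_univ]
    _ = A.card.choose s * (Fintype.card α - s).choose (k - s) := by
        rw [sum_const, card_powersetCard, smul_eq_mul]

/-- Markov's inequality for the number of `s`-element subsets of `A` contained in a `k`-element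
set. -/
theorem card_filter_le_card_inter_mul_choose_le {α : Type*} [Fintype α] [DecidableEq α]
    (A : Finset α) {k s : ℕ} (hs : s ≤ k) (r : ℕ) :
    ((powersetCard k (univ : Finset α)).filter (fun B => r ≤ (A ∩ B).card)).card * r.choose s ≤
      A.card.choose s * (Fintype.card α - s).choose (k - s) := by
  rw [← sum_choose_card_inter_powersetCard A hs, ← smul_eq_mul, ← sum_const]
  calc _ ≤ ∑ B ∈ (powersetCard k (univ : Finset α)).filter (fun B => r ≤ (A ∩ B).card),
        (A ∩ B).card.choose s :=
        sum_le_sum fun B hB => Nat.choose_le_choose s (mem_filter.1 hB).2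
    _ ≤ _ := sum_le_sum_of_subset (filter_subset _ _)

/-- (Lemma A.1 of the paper, for uniformly random `k`-subsets.)
If `Ω ⊆ {1,…,m}` is a fixed set of size `k` and `Ω'` is a uniformly random `k`-element
subset of `{1,…,m}`, then for every `r ≥ 3` the probability that `|Ω ∩ Ω'| ≥ r` is at
most `C(k,3)·(k/m)³ / C(r,3)`. -/
theorem prob_large_intersection_le
    (m k : ℕ) (hm : 0 < m) (hk : 0 < k) (hkm : k ≤ m)
    (Ω : Finset (Fin m)) (hΩ : Ω.card = k) (r : ℕ) (hr : 3 ≤ r) :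
    (((Finset.powersetCard k (Finset.univ : Finset (Fin m))).filter
          (fun Ω' => r ≤ (Ω ∩ Ω').card)).card : ℝ) /
        ((Finset.powersetCard k (Finset.univ : Finset (Fin m))).card : ℝ) ≤
      (k.choose 3 : ℝ) * ((k : ℝ) / (m : ℝ)) ^ 3 / (r.choose 3 : ℝ) := by
  rcases lt_or_ge k 3 with hk3 | hk3
  · have hempty : (powersetCard k (univ : Finset (Fin m))).filter
        (fun Ω' => r ≤ (Ω ∩ Ω').card) = ∅ := by
      refine filter_eq_empty_iff.2 fun B _ hB => ?_
      have := card_le_card (inter_subset_left : Ω ∩ B ⊆ Ω)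
      omega
    rw [hempty, card_empty, Nat.cast_zero, zero_div]
    positivity
  have markov := card_filter_le_card_inter_mul_choose_le Ω hk3 r
  rw [hΩ, Fintype.card_fin] at markov
  rw [card_powersetCard, card_univ, Fintype.card_fin]
  set N := ((powersetCard k (univ : Finset (Fin m))).filter (fun Ω' => r ≤ (Ω ∩ Ω').card)).card
  have hmk : 0 < m.choose k := Nat.choose_pos hkm
  have hm3 : 0 < m.choose 3 := Nat.choose_pos (hk3.trans hkm)
  have hr3 : 0 < r.choose 3 := Nat.choose_pos hr
  have key : N * r.choose 3 * m ^ 3 ≤ k.choose 3 * k ^ 3 * m.choose k := by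
    refine Nat.le_of_mul_le_mul_right ?_ hm3
    calc N * r.choose 3 * m ^ 3 * m.choose 3
        ≤ k.choose 3 * (m - 3).choose (k - 3) * m ^ 3 * m.choose 3 := by gcongr
      _ = k.choose 3 * (m.choose 3 * (m - 3).choose (k - 3)) * m ^ 3 := by ring
      _ = k.choose 3 * m.choose k * (k.choose 3 * m ^ 3) := by
          rw [← Nat.choose_mul hk3]; ring
      _ ≤ k.choose 3 * m.choose k * (k ^ 3 * m.choose 3) :=
          Nat.mul_le_mul_left _ (choose_mul_pow_le_pow_mul_choose hkm 3)
      _ = k.choose 3 * k ^ 3 * m.choose k * m.choose 3 := by ring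
  have keyR : (N : ℝ) * r.choose 3 * m ^ 3 ≤ k.choose 3 * k ^ 3 * m.choose k := by
    exact_mod_cast key
  rw [div_pow, mul_div_assoc', div_div, div_le_div_iff₀ (by positivity) (by positivity)]
  linarith
end

section
/- Let m, k be positive integers with k ≤ m, let S₁, S₂, S₃ ⊆ {1, …, m} be pairwise disjoint sets, and let Ω be a uniformly random k-element subset of {1, …, m}. Then the probability that Ω intersects all three sets S₁, S₂ and S₃ satisfies Pr[Ω ∩ S₁ ≠ ∅ and Ω ∩ S₂ ≠ ∅ and Ω ∩ S₃ ≠ ∅] ≤ (k³·|S₁|·|S₂|·|S₃|)/m³. -/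
open Finset

theorem pow_mul_choose_sub_le {m k s : ℕ} (hkm : k ≤ m) (hs : s ≤ k) :
    m ^ s * (m - s).choose (k - s) ≤ k ^ s * m.choose k := by
  induction s with
  | zero => simp
  | succ s ih =>
    have ih := ih (by omega)
    obtain ⟨j, rfl⟩ := Nat.exists_eq_add_of_le hs
    obtain ⟨n, rfl⟩ := Nat.exists_eq_add_of_le hkm
    have e1 : s + 1 + j + n - s = (j + n) + 1 := by omega
    have e2 : s + 1 + j - s = j + 1 := by omega
    have e3 : s + 1 + j + n - (s + 1) = j + n := by omega
    have e4 : s + 1 + j - (s + 1) = j := by omega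
    rw [e1, e2] at ih
    rw [e3, e4]
    have hc := Nat.add_one_mul_choose_eq (j + n) j
    have hr : (s + 1 + j + n) * (j + 1) ≤ (s + 1 + j) * (j + n + 1) := by nlinarith
    refine le_of_mul_le_mul_left ?_ (Nat.succ_pos (j + n))
    set M := s + 1 + j + n
    set K := s + 1 + j
    calc (j + n + 1) * (M ^ (s + 1) * (j + n).choose j)
        = M ^ (s + 1) * ((j + n + 1) * (j + n).choose j) := by ring
      _ = (M * (j + 1)) * (M ^ s * (j + n + 1).choose (j + 1)) := by rw [hc]; ring
      _ ≤ (K * (j + n + 1)) * (K ^ s * M.choose K) := Nat.mul_le_mul hr ih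
      _ = (j + n + 1) * (K ^ (s + 1) * M.choose K) := by ring

theorem card_powersetCard_filter_superset_mul_pow_le {α : Type*} [Fintype α] [DecidableEq α]
    {k : ℕ} (hk : k ≤ Fintype.card α) (T : Finset α) :
    #{Ω ∈ powersetCard k (univ : Finset α) | T ⊆ Ω} * Fintype.card α ^ #T ≤
      k ^ #T * (Fintype.card α).choose k := by
  rcases le_or_gt #T k with hT | hT
  · have h : #{Ω ∈ powersetCard k (univ : Finset α) | T ⊆ Ω} ≤
        #(powersetCard (k - #T) Tᶜ) := by
      refine card_le_card_of_injOn (· \ T) ?_ ?_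
      · intro Ω hΩ
        simp only [coe_filter, mem_powersetCard_univ, Set.mem_ofPred_eq] at hΩ
        simp only [mem_coe, mem_powersetCard]
        refine ⟨fun x hx => by simp_all, by rw [card_sdiff_of_subset hΩ.2, hΩ.1]⟩
      · intro A hA B hB h
        simp only [coe_filter, Set.mem_ofPred_eq] at hA hB
        rw [← sdiff_union_of_subset hA.2, ← sdiff_union_of_subset hB.2]
        exact congrArg (· ∪ T) h
    rw [card_powersetCard, card_compl] at h
    rw [mul_comm]
    exact (Nat.mul_le_mul_left _ h).trans (pow_mul_choose_sub_le hk hT)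
  · have h : {Ω ∈ powersetCard k (univ : Finset α) | T ⊆ Ω} = ∅ := by
      refine filter_eq_empty_iff.2 fun Ω hΩ h => ?_
      have := card_le_card h
      rw [mem_powersetCard_univ] at hΩ
      omega
    simp [h]

/-- If `S₁, S₂, S₃ ⊆ {1,…,m}` are pairwise disjoint and `Ω` is a
uniformly random `k`-element subset of `{1,…,m}`, then the probability that `Ω` meets
all three sets is at most `k³·|S₁|·|S₂|·|S₃|/m³`. -/
theorem prob_hits_three_disjoint_sets_le
    (m k : ℕ) (hm : 0 < m) (hk : 0 < k) (hkm : k ≤ m)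
    (S₁ S₂ S₃ : Finset (Fin m))
    (h12 : Disjoint S₁ S₂) (h13 : Disjoint S₁ S₃) (h23 : Disjoint S₂ S₃) :
    (((Finset.powersetCard k (Finset.univ : Finset (Fin m))).filter
          (fun Ω => (Ω ∩ S₁).Nonempty ∧ (Ω ∩ S₂).Nonempty ∧ (Ω ∩ S₃).Nonempty)).card : ℝ) /
        ((Finset.powersetCard k (Finset.univ : Finset (Fin m))).card : ℝ) ≤
      (k : ℝ) ^ 3 * S₁.card * S₂.card * S₃.card / (m : ℝ) ^ 3 := by
  set F := (Finset.powersetCard k (Finset.univ : Finset (Fin m))).filter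
    (fun Ω => (Ω ∩ S₁).Nonempty ∧ (Ω ∩ S₂).Nonempty ∧ (Ω ∩ S₃).Nonempty)
  let G : Fin m × Fin m × Fin m → Finset (Finset (Fin m)) := fun p =>
    {Ω ∈ powersetCard k (univ : Finset (Fin m)) | {p.1, p.2.1, p.2.2} ⊆ Ω}
  have hsub : F ⊆ (S₁ ×ˢ S₂ ×ˢ S₃).biUnion G := by
    intro Ω hΩ
    obtain ⟨hΩ, ⟨a, ha⟩, ⟨b, hb⟩, ⟨c, hc⟩⟩ := mem_filter.1 hΩ
    rw [mem_inter] at ha hb hc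
    refine mem_biUnion.2 ⟨(a, b, c), by simp [ha.2, hb.2, hc.2], mem_filter.2 ⟨hΩ, ?_⟩⟩
    simp [insert_subset_iff, ha.1, hb.1, hc.1]
  have hG : ∀ p ∈ S₁ ×ˢ S₂ ×ˢ S₃, #(G p) * m ^ 3 ≤ k ^ 3 * m.choose k := by
    rintro ⟨a, b, c⟩ hp
    simp only [mem_product] at hp
    have hcard : #({a, b, c} : Finset (Fin m)) = 3 := card_eq_three.2
      ⟨a, b, c, fun e => disjoint_left.1 h12 hp.1 (e ▸ hp.2.1),
        fun e => disjoint_left.1 h13 hp.1 (e ▸ hp.2.2),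
        fun e => disjoint_left.1 h23 hp.2.1 (e ▸ hp.2.2), rfl⟩
    simpa [hcard, G] using card_powersetCard_filter_superset_mul_pow_le
      (α := Fin m) (by simpa using hkm) {a, b, c}
  have key : #F * m ^ 3 ≤ k ^ 3 * #S₁ * #S₂ * #S₃ * m.choose k := by
    calc #F * m ^ 3 ≤ (∑ p ∈ S₁ ×ˢ S₂ ×ˢ S₃, #(G p)) * m ^ 3 :=
          Nat.mul_le_mul_right _ ((card_le_card hsub).trans card_biUnion_le)
      _ = ∑ p ∈ S₁ ×ˢ S₂ ×ˢ S₃, #(G p) * m ^ 3 := sum_mul ..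
      _ ≤ #(S₁ ×ˢ S₂ ×ˢ S₃) • (k ^ 3 * m.choose k) := sum_le_card_nsmul _ _ _ hG
      _ = k ^ 3 * #S₁ * #S₂ * #S₃ * m.choose k := by
          rw [card_product, card_product, smul_eq_mul]; ring
  have hpos : 0 < m.choose k := Nat.choose_pos hkm
  rw [card_powersetCard, card_univ, Fintype.card_fin,
    div_le_div_iff₀ (by exact_mod_cast hpos) (by positivity)]
  exact_mod_cast key
end

section
/- Let m, k be positive integers with 6k² ≤ m, let Ω¹, Ω², Ω³ ⊆ {1, …, m} be sets each of size at most k, and let i be an index with i ∈ Ω¹ ∩ Ω² ∩ Ω³. Let Ω be a uniformly random k-element subset of {1, …, m}. Then the probability that Ω ∩ Ω¹ = Ω ∩ Ω² = Ω ∩ Ω³ = {i} is at least k/(2m). -/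
open Finset

lemma choose_add_le_choose_add_mul (t s r : ℕ) :
    (t + s).choose (r + 1) ≤ t.choose (r + 1) + s * (t + s - 1).choose r := by
  induction s with
  | zero => simp
  | succ s ih =>
    have h₁ : (t + s + 1).choose (r + 1) = (t + s).choose r + (t + s).choose (r + 1) :=
      Nat.choose_succ_succ _ _
    have h₂ : s * (t + s - 1).choose r ≤ s * (t + s).choose r :=
      Nat.mul_le_mul_left _ (Nat.choose_le_choose r (by omega))
    rw [← add_assoc, h₁, Nat.add_sub_cancel, Nat.succ_mul]
    omega

lemma choose_add_le_two_mul_choose (t s r : ℕ) (h : 2 * s * r ≤ t + s) :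
    (t + s).choose r ≤ 2 * t.choose r := by
  obtain _ | r := r
  · simp
  obtain hn | hn := Nat.eq_zero_or_pos (t + s)
  · simp [hn]
  obtain ⟨n, hn'⟩ : ∃ n, t + s = n + 1 := ⟨t + s - 1, by omega⟩
  have h₁ := choose_add_le_choose_add_mul t s r
  have h₂ := Nat.add_one_mul_choose_eq n r
  rw [hn'] at h h₁ ⊢
  rw [Nat.add_sub_cancel] at h₁
  have h₃ : 2 * (s * n.choose r) ≤ (n + 1).choose (r + 1) := by
    refine le_of_mul_le_mul_left ?_ n.succ_pos
    calc (n + 1) * (2 * (s * n.choose r)) = 2 * s * ((n + 1) * n.choose r) := by ring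
      _ = 2 * s * (r + 1) * (n + 1).choose (r + 1) := by rw [h₂]; ring
      _ ≤ _ := Nat.mul_le_mul_right _ h
  omega

lemma choose_card_compl_le_card_filter_inter_eq_singleton {α : Type*} [Fintype α] [DecidableEq α]
    (k : ℕ) (A B C : Finset α) (i : α) (hi : i ∈ A ∩ B ∩ C) :
    ((A ∪ B ∪ C)ᶜ.card).choose k ≤
      ((powersetCard (k + 1) (univ : Finset α)).filter
        (fun S => S ∩ A = {i} ∧ S ∩ B = {i} ∧ S ∩ C = {i})).card := by
  simp only [mem_inter] at hi
  obtain ⟨⟨hA, hB⟩, hC⟩ := hi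
  have notMem {S : Finset α} (hS : S ⊆ (A ∪ B ∪ C)ᶜ) : i ∉ S := fun h => by
    have := hS h
    simp [hA] at this
  have inter_eq {S D : Finset α} (hS : S ⊆ (A ∪ B ∪ C)ᶜ) (hD : D ⊆ A ∪ B ∪ C) (hiD : i ∈ D) :
      insert i S ∩ D = {i} := by
    rw [insert_inter_of_mem hiD, disjoint_iff_inter_eq_empty.mp
      ((disjoint_compl_left (a := A ∪ B ∪ C)).mono hS hD)]
    rfl
  rw [← card_powersetCard]
  refine card_le_card_of_injOn (insert i) ?_ ?_
  · intro S hS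
    obtain ⟨hS, hc⟩ := mem_powersetCard.mp hS
    simp only [mem_coe, mem_filter, mem_powersetCard, subset_univ, true_and]
    exact ⟨by rw [card_insert_of_notMem (notMem hS), hc],
      inter_eq hS (by grind) hA, inter_eq hS (by grind) hB, inter_eq hS (by grind) hC⟩
  · intro S hS T hT hST
    rw [← erase_insert (notMem (mem_powersetCard.mp hS).1),
      ← erase_insert (notMem (mem_powersetCard.mp hT).1)]
    exact congrArg (fun X => X.erase i) hST

/-- (Essentially Claim 3.1 of the paper, for uniformly random
`k`-subsets.) Suppose `6k² ≤ m`, the sets `Ω¹, Ω², Ω³ ⊆ {1,…,m}` have size at most `k`,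
and `i ∈ Ω¹ ∩ Ω² ∩ Ω³`. If `Ω` is a uniformly random `k`-element subset of `{1,…,m}`,
then the probability that `Ω ∩ Ω¹ = Ω ∩ Ω² = Ω ∩ Ω³ = {i}` is at least `k/(2m)`. -/
theorem prob_unique_common_intersection_ge
    (m k : ℕ) (hm : 0 < m) (hk : 0 < k) (hkm : 6 * k ^ 2 ≤ m)
    (Ω₁ Ω₂ Ω₃ : Finset (Fin m))
    (hΩ₁ : Ω₁.card ≤ k) (hΩ₂ : Ω₂.card ≤ k) (hΩ₃ : Ω₃.card ≤ k)
    (i : Fin m) (hi : i ∈ Ω₁ ∩ Ω₂ ∩ Ω₃) :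
    (k : ℝ) / (2 * m) ≤
      (((Finset.powersetCard k (Finset.univ : Finset (Fin m))).filter
            (fun Ω => Ω ∩ Ω₁ = {i} ∧ Ω ∩ Ω₂ = {i} ∧ Ω ∩ Ω₃ = {i})).card : ℝ) /
        ((Finset.powersetCard k (Finset.univ : Finset (Fin m))).card : ℝ) := by
  obtain ⟨r, rfl⟩ : ∃ r, k = r + 1 := ⟨k - 1, by omega⟩
  obtain ⟨n, rfl⟩ : ∃ n, m = n + 1 := ⟨m - 1, by omega⟩
  have hcount := choose_card_compl_le_card_filter_inter_eq_singleton r Ω₁ Ω₂ Ω₃ i hi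
  have hcompl := card_compl_add_card (Ω₁ ∪ Ω₂ ∪ Ω₃)
  rw [Fintype.card_fin] at hcompl
  simp only [mem_inter] at hi
  obtain ⟨⟨hi₁, hi₂⟩, hi₃⟩ := hi
  have hunion : 1 ≤ (Ω₁ ∪ Ω₂ ∪ Ω₃).card ∧ (Ω₁ ∪ Ω₂ ∪ Ω₃).card ≤ 3 * r + 1 := by
    have h₁₂ := card_union_add_card_inter Ω₁ Ω₂
    have h₁₂₃ := card_union_add_card_inter (Ω₁ ∪ Ω₂) Ω₃
    have := card_pos.mpr ⟨i, mem_inter.mpr ⟨hi₁, hi₂⟩⟩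
    have := card_pos.mpr ⟨i, mem_inter.mpr ⟨mem_union_left Ω₂ hi₁, hi₃⟩⟩
    have := card_pos.mpr ⟨i, mem_union_left Ω₃ (mem_union_left Ω₂ hi₁)⟩
    omega
  obtain ⟨s, hs⟩ : ∃ s, (Ω₁ ∪ Ω₂ ∪ Ω₃).card = s + 1 :=
    ⟨(Ω₁ ∪ Ω₂ ∪ Ω₃).card - 1, by omega⟩
  generalize (Ω₁ ∪ Ω₂ ∪ Ω₃)ᶜ.card = t at hcount hcompl
  obtain rfl : n = t + s := by omega
  have hchoose := choose_add_le_two_mul_choose t s r (by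
    have : s * r ≤ 3 * r * r := Nat.mul_le_mul_right _ (by omega)
    nlinarith)
  have hpascal := Nat.add_one_mul_choose_eq (t + s) r
  rw [card_powersetCard, card_univ, Fintype.card_fin]
  have hpos : 0 < (t + s + 1).choose (r + 1) := Nat.choose_pos (by nlinarith)
  rw [div_le_div_iff₀ (by positivity) (by exact_mod_cast hpos)]
  norm_cast
  calc (r + 1) * (t + s + 1).choose (r + 1) = (t + s + 1) * (t + s).choose r := by
        rw [hpascal, mul_comm]
    _ ≤ (t + s + 1) * (2 * _) :=
        Nat.mul_le_mul_left _ (hchoose.trans (Nat.mul_le_mul_left 2 hcount))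
    _ = _ := by ring
end
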